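/- For every d-dimensional rational polytope P ⊆ ℝ^d there exists a finite set S ⊆ ℤ^d ∖ {0} such that F(P) = {x ∈ ℝ^d : ⟨x, ν⟩ ≥ Min_P(ν) + 1 for all ν ∈ S}; in particular, F(P) is either empty or a (compact) rational polytope, i.e., the convex hull of finitely many points of ℚ^d. -/

import Mathlib

open Set MeasureTheory

noncomputable section

/-- The real vector corresponding to an integer vector. -/
def intVec {d : ℕ} (ν : Fin d → ℤ) : Fin d → ℝ := fun i => (ν i : ℝ)

/-- The standard inner product on `ℝ^d`. -/
def dotR {d : ℕ} (x y : Fin d → ℝ) : ℝ := ∑ i, x i * y i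

/-- `Min_P(ν) = min_{x ∈ P} ⟨x, ν⟩`. -/
def MinP {d : ℕ} (P : Set (Fin d → ℝ)) (ν : Fin d → ℝ) : ℝ :=
  sInf ((fun x => dotR x ν) '' P)

/-- The set of lattice points of `ℝ^d`. -/
def latticePts (d : ℕ) : Set (Fin d → ℝ) := Set.range intVec

/-- The set of rational points of `ℝ^d`. -/
def ratPts (d : ℕ) : Set (Fin d → ℝ) := {x | ∀ i, ∃ q : ℚ, x i = (q : ℝ)}

/-- The Fine interior of `P`. -/
def fineInt {d : ℕ} (P : Set (Fin d → ℝ)) : Set (Fin d → ℝ) :=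
  {x | ∀ ν : Fin d → ℤ, ν ≠ 0 → MinP P (intVec ν) + 1 ≤ dotR x (intVec ν)}

/-- A lattice polytope: the convex hull of a finite set of lattice points. -/
def IsLatticePolytope {d : ℕ} (P : Set (Fin d → ℝ)) : Prop :=
  ∃ A : Finset (Fin d → ℝ), ↑A ⊆ latticePts d ∧ P = convexHull ℝ (A : Set (Fin d → ℝ))

/-- A rational polytope: the convex hull of a finite set of rational points. -/
def IsRatPolytope {d : ℕ} (P : Set (Fin d → ℝ)) : Prop :=
  ∃ A : Finset (Fin d → ℝ), ↑A ⊆ ratPts d ∧ P = convexHull ℝ (A : Set (Fin d → ℝ))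

/-- A subset of `ℝ^d` is full-dimensional if its affine span is everything. -/
def IsFullDim {d : ℕ} (P : Set (Fin d → ℝ)) : Prop := affineSpan ℝ P = ⊤

/-- `P` is F-hollow if its Fine interior is empty. -/
def FHollow {d : ℕ} (P : Set (Fin d → ℝ)) : Prop := fineInt P = ∅

/-- The dilation `λP = {λx : x ∈ P}`. -/
def dilate {d : ℕ} (lam : ℝ) (P : Set (Fin d → ℝ)) : Set (Fin d → ℝ) :=
  (fun x => lam • x) '' P

/-- The minimal multiplier `μ(P)`. -/
def minMult {d : ℕ} (P : Set (Fin d → ℝ)) : ℝ :=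
  sInf {lam : ℝ | 0 < lam ∧ (fineInt (dilate lam P)).Nonempty}

/-- Unimodular equivalence of subsets of `ℝ^d`. -/
def UnimodEquiv {d : ℕ} (P₁ P₂ : Set (Fin d → ℝ)) : Prop :=
  ∃ φ : (Fin d → ℝ) ≃ᵃ[ℝ] (Fin d → ℝ),
    φ '' latticePts d = latticePts d ∧ φ '' P₁ = P₂

/-- An affine map `ℝ^d → ℝ^k` inducing a surjection of lattices. -/
def IsLatticeProj {d k : ℕ} (π : (Fin d → ℝ) →ᵃ[ℝ] (Fin k → ℝ)) : Prop :=
  π '' latticePts d = latticePts k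

/-- A sporadic F-hollow lattice polytope: a full-dimensional F-hollow lattice
polytope admitting no lattice projection onto a lower-dimensional F-hollow
lattice polytope. -/
def IsSporadic {d : ℕ} (P : Set (Fin d → ℝ)) : Prop :=
  IsLatticePolytope P ∧ IsFullDim P ∧ FHollow P ∧
  ¬ ∃ (k : ℕ) (_ : 1 ≤ k) (_ : k ≤ d - 1) (π : (Fin d → ℝ) →ᵃ[ℝ] (Fin k → ℝ)),
      IsLatticeProj π ∧ IsLatticePolytope (π '' P) ∧ IsFullDim (π '' P) ∧
      FHollow (π '' P)

/-- A weakly sporadic F-hollow lattice polytope: a full-dimensional F-hollow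
lattice polytope `P` such that `F(μ(P)·P)` is a single point. -/
def IsWeaklySporadic {d : ℕ} (P : Set (Fin d → ℝ)) : Prop :=
  IsLatticePolytope P ∧ IsFullDim P ∧ FHollow P ∧
  ∃ p : Fin d → ℝ, fineInt (dilate (minMult P) P) = {p}

/-- The support `S_F(P)` of the Fine interior of `P`. -/
def suppF {d : ℕ} (P : Set (Fin d → ℝ)) : Set (Fin d → ℤ) :=
  {ν | MinP (fineInt P) (intVec ν) = MinP P (intVec ν) + 1}

/-- The dimension of the affine span of a set. -/
def aDim {d : ℕ} (S : Set (Fin d → ℝ)) : ℕ :=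
  Module.finrank ℝ (affineSpan ℝ S).direction

/-- Lebesgue volume of a subset of `ℝ^d`, as a real number. -/
def vol {d : ℕ} (S : Set (Fin d → ℝ)) : ℝ := (volume S).toReal

theorem dotR_add_left {d : ℕ} (x y z : Fin d → ℝ) : dotR (x + y) z = dotR x z + dotR y z :=
  add_dotProduct x y z

theorem dotR_sub_left {d : ℕ} (x y z : Fin d → ℝ) : dotR (x - y) z = dotR x z - dotR y z :=
  sub_dotProduct x y z

theorem dotR_smul_left {d : ℕ} (c : ℝ) (x y : Fin d → ℝ) : dotR (c • x) y = c * dotR x y :=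
  smul_dotProduct c x y

theorem dotR_add_right {d : ℕ} (x y z : Fin d → ℝ) : dotR x (y + z) = dotR x y + dotR x z :=
  dotProduct_add x y z

theorem intVec_add {d : ℕ} (μ ν : Fin d → ℤ) : intVec (μ + ν) = intVec μ + intVec ν := by
  ext i; simp [intVec]

theorem dotR_intVec {d : ℕ} (μ ν : Fin d → ℤ) :
    dotR (intVec μ) (intVec ν) = ((μ ⬝ᵥ ν : ℤ) : ℝ) := by
  simp [dotR, intVec, dotProduct]

theorem continuous_dotR_left {d : ℕ} (y : Fin d → ℝ) : Continuous fun x => dotR x y := by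
  unfold dotR; fun_prop

theorem isLinearMap_dotR_left {d : ℕ} (y : Fin d → ℝ) : IsLinearMap ℝ fun x => dotR x y :=
  ⟨fun x z => dotR_add_left x z y, fun c x => dotR_smul_left c x y⟩

theorem exists_rat_dotR {d : ℕ} {x : Fin d → ℝ} (hx : x ∈ ratPts d) (ν : Fin d → ℤ) :
    ∃ q : ℚ, dotR x (intVec ν) = q := by
  choose q hq using hx
  exact ⟨∑ i, q i * ν i, by simp [dotR, intVec, hq]⟩

theorem sub_mem_ratPts {d : ℕ} {x y : Fin d → ℝ} (hx : x ∈ ratPts d) (hy : y ∈ ratPts d) :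
    x - y ∈ ratPts d := by
  intro i
  obtain ⟨p, hp⟩ := hx i
  obtain ⟨q, hq⟩ := hy i
  exact ⟨p - q, by simp [hp, hq]⟩

/-- A rational vector has a positive integral multiple. -/
theorem exists_pos_smul_eq_intVec {d : ℕ} {x : Fin d → ℝ} (hx : x ∈ ratPts d) :
    ∃ (n : ℝ) (w : Fin d → ℤ), 0 < n ∧ n • x = intVec w := by
  choose q hq using hx
  refine ⟨∏ i, ((q i).den : ℝ), fun i => (q i).num * ∏ j ∈ Finset.univ.erase i, ((q j).den : ℤ),
    Finset.prod_pos fun i _ => by exact_mod_cast (q i).den_pos, ?_⟩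
  ext i
  have h : (q i : ℝ) * (q i).den = (q i).num := by exact_mod_cast Rat.mul_den_eq_num (q i)
  simp only [intVec, Pi.smul_apply, smul_eq_mul, hq]
  rw [← Finset.mul_prod_erase _ _ (Finset.mem_univ i)]
  push_cast
  rw [← h]
  ring

/-- The minimum of a linear form over a polytope is attained at any minimizing vertex. -/
theorem MinP_convexHull {d : ℕ} {A : Set (Fin d → ℝ)} {a ν : Fin d → ℝ} (ha : a ∈ A)
    (hmin : ∀ b ∈ A, dotR a ν ≤ dotR b ν) : MinP (convexHull ℝ A) ν = dotR a ν := by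
  refine IsLeast.csInf_eq ⟨⟨a, subset_convexHull ℝ A ha, rfl⟩, ?_⟩
  rintro _ ⟨x, hx, rfl⟩
  exact convexHull_min (t := {y | dotR a ν ≤ dotR y ν}) hmin
    (convex_halfSpace_ge (isLinearMap_dotR_left ν) _) hx

/-- **Gordan's lemma**: the lattice points of a cone given by finitely many integral inequalities
form a finitely generated monoid. -/
theorem fg_comap_nonneg {d : ℕ} {ι : Type} [Finite ι] (f : (Fin d → ℤ) →+ (ι → ℤ)) :
    ((AddSubmonoid.nonneg (ι → ℤ)).comap f).FG := by
  let castHom (κ : Type) : (κ → ℕ) →+ (κ → ℤ) := (Nat.castAddMonoidHom ℤ).compLeft κ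
  let pos : (Fin d → ℕ) × (Fin d → ℕ) × (ι → ℕ) →+ (Fin d → ℤ) :=
    (castHom (Fin d)).comp (AddMonoidHom.fst _ _)
  let neg : (Fin d → ℕ) × (Fin d → ℕ) × (ι → ℕ) →+ (Fin d → ℤ) :=
    (castHom (Fin d)).comp ((AddMonoidHom.fst _ _).comp (AddMonoidHom.snd _ _))
  let slack : (Fin d → ℕ) × (Fin d → ℕ) × (ι → ℕ) →+ (ι → ℤ) :=
    (castHom ι).comp ((AddMonoidHom.snd _ _).comp (AddMonoidHom.snd _ _))
  have hsol (x) : (f.comp pos) x = (f.comp neg + slack) x ↔ f (pos x - neg x) = slack x := by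
    rw [map_sub, sub_eq_iff_eq_add']
    rfl
  convert (AddSubmonoid.fg_eqLocusM (f.comp pos) (f.comp neg + slack)).map (pos - neg) using 1
  ext ν
  simp only [AddSubmonoid.mem_comap, AddSubmonoid.mem_nonneg, AddSubmonoid.mem_map,
    AddMonoidHom.mem_eqLocusM, hsol]
  constructor
  · intro hν
    have hdiff : pos (fun i => (ν i).toNat, fun i => (-ν i).toNat, fun j => (f ν j).toNat) -
        neg (fun i => (ν i).toNat, fun i => (-ν i).toNat, fun j => (f ν j).toNat) = ν := by
      ext i
      simp only [pos, neg, castHom, AddMonoidHom.comp_apply, Pi.sub_apply, AddMonoidHom.coe_fst,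
        AddMonoidHom.coe_snd, AddMonoidHom.compLeft_apply, Function.comp_apply,
        Nat.coe_castAddMonoidHom]
      lia
    refine ⟨_, ?_, hdiff⟩
    rw [hdiff]
    ext j
    exact (Int.toNat_of_nonneg (hν j)).symm
  · rintro ⟨x, hx, rfl⟩
    rw [AddMonoidHom.sub_apply, hx]
    exact fun j => Int.natCast_nonneg _

/-- The lattice points of the normal cone of `A` at `a` form a finitely generated monoid. -/
theorem exists_fg_normalCone {d : ℕ} {A : Finset (Fin d → ℝ)} (hA : ↑A ⊆ ratPts d)
    {a : Fin d → ℝ} (ha : a ∈ A) :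
    ∃ C : AddSubmonoid (Fin d → ℤ), C.FG ∧
      ∀ ν, ν ∈ C ↔ ∀ b ∈ A, dotR a (intVec ν) ≤ dotR b (intVec ν) := by
  choose n w hn hw using fun b : A =>
    exists_pos_smul_eq_intVec (sub_mem_ratPts (hA b.2) (hA ha))
  let f : (Fin d → ℤ) →+ (A → ℤ) :=
    { toFun := fun ν b => w b ⬝ᵥ ν
      map_zero' := by ext; simp
      map_add' := fun μ ν => by ext; simp [dotProduct_add] }
  refine ⟨_, fg_comap_nonneg f, fun ν => ?_⟩
  have key (b : A) : 0 ≤ f ν b ↔ dotR a (intVec ν) ≤ dotR b (intVec ν) := by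
    have h : ((f ν b : ℤ) : ℝ) = n b * (dotR b (intVec ν) - dotR a (intVec ν)) := by
      rw [← dotR_sub_left, ← dotR_smul_left, hw, dotR_intVec]
      rfl
    rw [← Int.cast_nonneg_iff (R := ℝ), h, mul_nonneg_iff_of_pos_left (hn b), sub_nonneg]
  rw [AddSubmonoid.mem_comap, AddSubmonoid.mem_nonneg, Pi.le_def, Subtype.forall]
  exact forall₂_congr fun b hb => key ⟨b, hb⟩

/-- Finitely many lattice directions suffice to cut out the Fine interior. -/
theorem exists_finset_fineInt_eq {d : ℕ} {A : Finset (Fin d → ℝ)} (hA : ↑A ⊆ ratPts d)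
    (hne : A.Nonempty) :
    ∃ S : Finset (Fin d → ℤ), 0 ∉ S ∧ fineInt (convexHull ℝ (A : Set (Fin d → ℝ))) =
      {x | ∀ ν ∈ S, MinP (convexHull ℝ (A : Set (Fin d → ℝ))) (intVec ν) + 1 ≤
        dotR x (intVec ν)} := by
  classical
  choose C hfg hC using fun a : A => exists_fg_normalCone hA a.2
  choose T hT using hfg
  refine ⟨(Finset.univ.biUnion T).erase 0, Finset.notMem_erase _ _, Set.Subset.antisymm
    (fun x hx ν hν => hx ν (Finset.ne_of_mem_erase hν)) fun x hx ν hν => ?_⟩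
  obtain ⟨a, ha, hmin⟩ := A.exists_min_image (fun b => dotR b (intVec ν)) hne
  have hMin {μ : Fin d → ℤ} (hμ : μ ∈ C ⟨a, ha⟩) :
      MinP (convexHull ℝ (A : Set (Fin d → ℝ))) (intVec μ) = dotR a (intVec μ) :=
    MinP_convexHull ha ((hC ⟨a, ha⟩ μ).1 hμ)
  have hνC : ν ∈ C ⟨a, ha⟩ := (hC ⟨a, ha⟩ ν).2 hmin
  rw [hMin hνC]
  refine (?_ : ν = 0 ∨ dotR a (intVec ν) + 1 ≤ dotR x (intVec ν)).resolve_left hν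
  rw [← hT ⟨a, ha⟩] at hνC
  clear hν hmin
  induction hνC using AddSubmonoid.closure_induction with
  | mem μ hμ =>
    refine or_iff_not_imp_left.2 fun h0 => ?_
    rw [← hMin (hT ⟨a, ha⟩ ▸ AddSubmonoid.subset_closure hμ)]
    exact hx μ (Finset.mem_erase.2 ⟨h0, Finset.mem_biUnion.2 ⟨⟨a, ha⟩, Finset.mem_univ _, hμ⟩⟩)
  | zero => exact Or.inl rfl
  | add μ₁ μ₂ _ _ h₁ h₂ =>
    rcases h₁ with rfl | h₁
    · simpa using h₂
    rcases h₂ with rfl | h₂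
    · simpa using Or.inr h₁
    rw [intVec_add, dotR_add_right, dotR_add_right]
    exact Or.inr (by linarith)

section RationalPolyhedron

variable {d : ℕ} {S : Finset (Fin d → ℤ)} {c : (Fin d → ℤ) → ℝ}

/-- At an extreme point of a polyhedron the active constraints span. -/
theorem eq_zero_of_orthogonal_active {x v : Fin d → ℝ}
    (hx : x ∈ {x : Fin d → ℝ | ∀ ν ∈ S, c ν ≤ dotR x (intVec ν)}.extremePoints ℝ)
    (hv : ∀ ν ∈ S, dotR x (intVec ν) = c ν → dotR v (intVec ν) = 0) : v = 0 := by
  have hnear (u : Fin d → ℝ) (hu : ∀ ν ∈ S, dotR x (intVec ν) = c ν → dotR u (intVec ν) = 0) :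
      ∀ᶠ t : ℝ in nhdsWithin 0 (Ioi 0), ∀ ν ∈ S, c ν ≤ dotR (x + t • u) (intVec ν) := by
    refine (Finset.eventually_all S).2 fun ν hν => ?_
    rcases (hx.1 ν hν).eq_or_lt with h | h
    · exact Filter.Eventually.of_forall fun t => by
        rw [dotR_add_left, dotR_smul_left, hu ν hν h.symm, mul_zero, add_zero, h]
    · have hcont : Continuous fun t : ℝ => dotR (x + t • u) (intVec ν) :=
        (continuous_dotR_left _).comp (by fun_prop)
      have hlt := (hcont.tendsto 0).eventually_const_lt (u := c ν) (by simpa using h)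
      exact (hlt.filter_mono nhdsWithin_le_nhds).mono fun t ht => ht.le
  obtain ⟨t, ⟨h₁, h₂⟩, ht⟩ := ((hnear v hv).and (hnear (-v) fun ν hν h => by
    rw [← neg_one_smul ℝ, dotR_smul_left, hv ν hν h, mul_zero])).and
      self_mem_nhdsWithin |>.exists
  have hseg : x ∈ openSegment ℝ (x + t • v) (x + t • -v) :=
    ⟨1 / 2, 1 / 2, by norm_num, by norm_num, by norm_num, by module⟩
  have := hx.2 h₁ h₂ hseg
  simpa [(show 0 < t from ht).ne'] using this

theorem finite_extremePoints_polyhedron :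
    ({x : Fin d → ℝ | ∀ ν ∈ S, c ν ≤ dotR x (intVec ν)}.extremePoints ℝ).Finite := by
  classical
  refine Set.Finite.of_finite_image (f := fun x => S.filter fun ν => dotR x (intVec ν) = c ν)
    (S.powerset.finite_toSet.subset ?_) fun x hx y hy hxy => ?_
  · rintro _ ⟨x, -, rfl⟩
    exact Finset.mem_coe.2 (Finset.mem_powerset.2 (Finset.filter_subset _ _))
  · refine sub_eq_zero.1 (eq_zero_of_orthogonal_active hx fun ν hν h => ?_)
    have hmem : ν ∈ S.filter fun ν => dotR y (intVec ν) = c ν :=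
      (Finset.ext_iff.1 hxy ν).1 (Finset.mem_filter.2 ⟨hν, h⟩)
    rw [dotR_sub_left, h, (Finset.mem_filter.1 hmem).2, sub_self]

/-- The extreme points of a rational polyhedron are rational. -/
theorem extremePoints_polyhedron_subset_ratPts (hc : ∀ ν ∈ S, ∃ q : ℚ, c ν = q) :
    {x : Fin d → ℝ | ∀ ν ∈ S, c ν ≤ dotR x (intVec ν)}.extremePoints ℝ ⊆ ratPts d := by
  intro x hx
  obtain ⟨r, hr⟩ := (Algebra.linearMap ℚ ℝ).exists_leftInverse_of_injective
    (LinearMap.ker_eq_bot.2 (algebraMap ℚ ℝ).injective)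
  have hr (q : ℚ) : r (q : ℝ) = q := LinearMap.congr_fun hr q
  suffices h : (fun i => ((r (x i) : ℚ) : ℝ)) - x = 0 from
    fun i => ⟨r (x i), (congrFun (sub_eq_zero.1 h) i).symm⟩
  refine eq_zero_of_orthogonal_active hx fun ν hν h => ?_
  obtain ⟨q, hq⟩ := hc ν hν
  have hrq : r (dotR x (intVec ν)) = q := by rw [h, hq, hr]
  have hsum : r (dotR x (intVec ν)) = ∑ i, r (x i) * ν i := by
    simp only [dotR, intVec, map_sum]
    refine Finset.sum_congr rfl fun i _ => ?_
    rw [mul_comm, ← zsmul_eq_mul, map_zsmul, zsmul_eq_mul, mul_comm]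
  rw [dotR_sub_left, h, hq, ← hrq, hsum]
  simp [dotR, intVec]

/-- A bounded rational polyhedron is a rational polytope. -/
theorem isRatPolytope_of_isBounded (hc : ∀ ν ∈ S, ∃ q : ℚ, c ν = q)
    (hb : Bornology.IsBounded {x : Fin d → ℝ | ∀ ν ∈ S, c ν ≤ dotR x (intVec ν)}) :
    IsRatPolytope {x : Fin d → ℝ | ∀ ν ∈ S, c ν ≤ dotR x (intVec ν)} := by
  have hinter : {x : Fin d → ℝ | ∀ ν ∈ S, c ν ≤ dotR x (intVec ν)} =
      ⋂ ν ∈ S, {x | c ν ≤ dotR x (intVec ν)} := by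
    ext; simp
  have hclosed : IsClosed {x : Fin d → ℝ | ∀ ν ∈ S, c ν ≤ dotR x (intVec ν)} := by
    rw [hinter]
    exact isClosed_biInter fun ν _ => isClosed_le continuous_const (continuous_dotR_left _)
  have hconv : Convex ℝ {x : Fin d → ℝ | ∀ ν ∈ S, c ν ≤ dotR x (intVec ν)} := by
    rw [hinter]
    exact convex_iInter₂ fun ν _ => convex_halfSpace_ge (isLinearMap_dotR_left _) _
  have hfin := finite_extremePoints_polyhedron (S := S) (c := c)
  refine ⟨hfin.toFinset, ?_, ?_⟩
  · rw [hfin.coe_toFinset]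
    exact extremePoints_polyhedron_subset_ratPts hc
  · rw [hfin.coe_toFinset, ← (hfin.isClosed_convexHull (𝕜 := ℝ)).closure_eq,
      closure_convexHull_extremePoints (Metric.isCompact_of_isClosed_isBounded hclosed hb) hconv]

end RationalPolyhedron

theorem isBounded_fineInt {d : ℕ} (P : Set (Fin d → ℝ)) : Bornology.IsBounded (fineInt P) := by
  refine (Metric.isBounded_Icc (fun i => MinP P (intVec (Pi.single i 1)) + 1)
    fun i => -(MinP P (intVec (-Pi.single i 1)) + 1)).subset fun x hx => ⟨fun i => ?_, fun i => ?_⟩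
  · simpa [dotR, intVec, Pi.single_apply] using hx (Pi.single i 1) (by simp)
  · have := hx (-Pi.single i 1) (by simp)
    rw [le_neg]
    simpa [dotR, intVec, Pi.single_apply] using this

/-- Finitely many inequalities suffice to cut out `F(P)`; in
particular `F(P)` is empty or a rational polytope. -/
theorem fineInt_finitely_many_ineq (d : ℕ) (P : Set (Fin d → ℝ))
    (hP : IsRatPolytope P) (hfull : IsFullDim P) :
    ∃ S : Finset (Fin d → ℤ), (0 : Fin d → ℤ) ∉ S ∧
      fineInt P = {x | ∀ ν ∈ S, MinP P (intVec ν) + 1 ≤ dotR x (intVec ν)} ∧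
      (fineInt P = ∅ ∨ IsRatPolytope (fineInt P)) := by
  obtain ⟨A, hA, rfl⟩ := hP
  have hne : A.Nonempty := by
    rw [IsFullDim, affineSpan_convexHull] at hfull
    rw [← Finset.coe_nonempty, ← affineSpan_nonempty ℝ, hfull]
    exact Set.univ_nonempty
  obtain ⟨S, hS0, hS⟩ := exists_finset_fineInt_eq hA hne
  refine ⟨S, hS0, hS, Or.inr ?_⟩
  have hb := isBounded_fineInt (convexHull ℝ (A : Set (Fin d → ℝ)))
  rw [hS] at hb ⊢
  refine isRatPolytope_of_isBounded (fun ν _ => ?_) hb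
  obtain ⟨a, ha, hmin⟩ := A.exists_min_image (fun b => dotR b (intVec ν)) hne
  obtain ⟨q, hq⟩ := exists_rat_dotR (hA ha) ν
  exact ⟨q + 1, by rw [MinP_convexHull ha hmin, hq]; push_cast; rfl⟩
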